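/- For $\mu>0$ and $d>0$ let $\mathcal P(\mu,d)$ be the set of Borel probability measures $P$ on $\mathbb R$ with $\mathbb E_P[X]=\mu$ and $\mathbb E_P[|X-\mu|]=d$. For a probability measure $P$ on $\mathbb R$ and a price $r>0$ let $\mathrm{REV}(r,P)=r\,P([r,\infty))$ and $\mathrm{OPT}(P)=\sup_{x>0}x\,P([x,\infty))$. Let $\mu>0$, $0<\delta<2$ and $d=\delta\mu$. Define $$\rho=\begin{cases}\dfrac{4+\delta-\sqrt{\delta^2+8\delta}}{4}&\text{if }0<\delta\le 2(\sqrt5-2),\\[2mm]\dfrac{2-\delta}{2+\delta}&\text{if }2(\sqrt5-2)\le\delta<2.\end{cases}$$ Then $0<\rho\mu<\mu$, and $r=\rho\mu$ is the unique minimizer, over all prices $r>0$, of the worst-case ratio $$\sup_{P\in\mathcal P(\mu,d)}\frac{\mathrm{OPT}(P)}{\mathrm{REV}(r,P)}\in[0,\infty]$$ (the supremum is taken in $[0,\infty]$, and the ratio is $+\infty$ if $\mathrm{REV}(r,P)=0$). The minimal value is $$\begin{cases}1+\dfrac{2\delta}{\sqrt{\delta^2+8\delta}-3\delta}&\text{if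 }0<\delta\le 2(\sqrt5-2),\\[2mm]1+\dfrac{8\delta}{(2-\delta)^2}&\text{if }2(\sqrt5-2)\le\delta<2.\end{cases}$$ In particular, the two formulas for $\rho$, and the two formulas for the minimal value, agree at $\delta=2(\sqrt5-2)$. -/

import Mathlib

open MeasureTheory
open scoped ENNReal

/-- The mean-MAD ambiguity set `P(μ,d)`: Borel probability measures on `ℝ` with mean `μ` and mean
absolute deviation `d`. (Integrability of `|x - μ|` follows from that of `x`.) -/
def madSet (μ d : ℝ) : Set (Measure ℝ) :=
  {P | IsProbabilityMeasure P ∧ Integrable (fun x : ℝ => x) P ∧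
    ∫ x, x ∂P = μ ∧ ∫ x, |x - μ| ∂P = d}

/-- The revenue `r · P([r,∞))` at a price `r > 0`, as an element of `[0,∞]`. -/
noncomputable def REV (r : ℝ) (P : Measure ℝ) : ℝ≥0∞ :=
  ENNReal.ofReal r * P (Set.Ici r)

/-- The optimal revenue: the supremum of the revenue over all prices `x > 0`. -/
noncomputable def OPT (P : Measure ℝ) : ℝ≥0∞ :=
  ⨆ (x : ℝ) (_ : 0 < x), REV x P

/-- The worst-case approximation ratio of the price `r` over `P(μ,d)`, as a supremum in `[0,∞]`;
it is `∞` when the ratios are unbounded, and a ratio with positive numerator and zero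
denominator is `∞`. -/
noncomputable def worstRatio (μ d r : ℝ) : ℝ≥0∞ :=
  ⨆ P ∈ madSet μ d, OPT P / REV r P

/-- `r` is the unique minimizer of the worst-case ratio among all positive prices, and the minimal
value is the real number `V ≥ 0`. -/
def IsOptimalPrice (μ d r V : ℝ) : Prop :=
  0 < r ∧ 0 ≤ V ∧ worstRatio μ d r = ENNReal.ofReal V ∧
    ∀ r' : ℝ, 0 < r' → r' ≠ r → ENNReal.ofReal V < worstRatio μ d r'

/-- The measure with mass `1 - q` at `a` and mass `q` at `b`. -/
noncomputable def twoPoint (q a b : ℝ) : Measure ℝ :=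
  ENNReal.ofReal (1 - q) • Measure.dirac a + ENNReal.ofReal q • Measure.dirac b

theorem integrable_twoPoint (q a b : ℝ) (f : ℝ → ℝ) : Integrable f (twoPoint q a b) :=
  ((integrable_dirac (by simp)).smul_measure ENNReal.ofReal_ne_top).add_measure
    ((integrable_dirac (by simp)).smul_measure ENNReal.ofReal_ne_top)

theorem integral_twoPoint {q : ℝ} (h0 : 0 ≤ q) (h1 : q ≤ 1) (a b : ℝ) (f : ℝ → ℝ) :
    ∫ x, f x ∂(twoPoint q a b) = (1 - q) * f a + q * f b := by
  rw [twoPoint, integral_add_measure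
    ((integrable_dirac (by simp)).smul_measure ENNReal.ofReal_ne_top)
    ((integrable_dirac (by simp)).smul_measure ENNReal.ofReal_ne_top)]
  simp [integral_smul_measure, h0, h1]

theorem twoPoint_mem_madSet {μ δ q : ℝ} (hμ : 0 < μ) (hδ : 0 < δ) (h0 : 0 < q) (h1 : q < 1) :
    twoPoint q ((1 - δ / (2 * (1 - q))) * μ) ((1 + δ / (2 * q)) * μ) ∈ madSet μ (δ * μ) := by
  have h1' : 0 < 1 - q := by linarith
  refine ⟨⟨?_⟩, integrable_twoPoint _ _ _ _, ?_, ?_⟩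
  · simp [twoPoint]
    rw [← ENNReal.ofReal_add h1'.le h0.le]
    simp
  · rw [integral_twoPoint h0.le h1.le]
    field_simp
    ring
  · rw [integral_twoPoint h0.le h1.le]
    have ha : (1 - δ / (2 * (1 - q))) * μ - μ = -(δ / (2 * (1 - q)) * μ) := by ring
    have hb : (1 + δ / (2 * q)) * μ - μ = δ / (2 * q) * μ := by ring
    rw [ha, hb, abs_neg, abs_of_nonneg (by positivity), abs_of_nonneg (by positivity)]
    field_simp
    norm_num

theorem REV_twoPoint_high {q a b r : ℝ} (ha : a < r) (hb : r ≤ b) :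
    REV r (twoPoint q a b) = ENNReal.ofReal r * ENNReal.ofReal q := by
  simp [REV, twoPoint, ha, hb, measurableSet_Ici]

theorem REV_twoPoint_low {q a b : ℝ} (h0 : 0 ≤ q) (h1 : q ≤ 1) (hab : a ≤ b) :
    REV a (twoPoint q a b) = ENNReal.ofReal a := by
  simp only [REV, twoPoint, Measure.add_apply, Measure.smul_apply, smul_eq_mul,
    Measure.dirac_apply' _ measurableSet_Ici]
  simp [hab, ← ENNReal.ofReal_add (sub_nonneg.2 h1) h0]

theorem REV_le_OPT {x : ℝ} (hx : 0 < x) (P : Measure ℝ) : REV x P ≤ OPT P :=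
  le_iSup₂ (f := fun (x : ℝ) (_ : 0 < x) => REV x P) x hx

theorem div_le_worstRatio {μ d r x : ℝ} (hx : 0 < x) {P : Measure ℝ} (hP : P ∈ madSet μ d) :
    REV x P / REV r P ≤ worstRatio μ d r :=
  (ENNReal.div_le_div_right (REV_le_OPT hx P) _).trans
    (le_iSup₂ (f := fun P (_ : P ∈ madSet μ d) => OPT P / REV r P) P hP)

theorem high_price_le_worstRatio {μ δ ρ q : ℝ} (hμ : 0 < μ) (hδ : 0 < δ) (hρ : 0 < ρ)
    (h0 : 0 < q) (h1 : q < 1) (hlow : 1 - δ / (2 * (1 - q)) < ρ) (hhigh : ρ ≤ 1 + δ / (2 * q)) :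
    ENNReal.ofReal ((1 + δ / (2 * q)) / ρ) ≤ worstRatio μ (δ * μ) (ρ * μ) := by
  have hb : 0 < (1 + δ / (2 * q)) * μ := by positivity
  have ha := mul_lt_mul_of_pos_right hlow hμ
  have hc := mul_le_mul_of_nonneg_right hhigh hμ.le
  refine le_trans (le_of_eq ?_) (div_le_worstRatio hb (twoPoint_mem_madSet hμ hδ h0 h1))
  rw [REV_twoPoint_high (ha.trans_le hc) le_rfl, REV_twoPoint_high ha hc,
    ← ENNReal.ofReal_mul hb.le, ← ENNReal.ofReal_mul (by positivity),
    ← ENNReal.ofReal_div_of_pos (by positivity)]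
  congr 1
  field_simp

theorem low_price_le_worstRatio {μ δ ρ q : ℝ} (hμ : 0 < μ) (hδ : 0 < δ) (hρ : 0 < ρ)
    (h0 : 0 < q) (h1 : q < 1) (hlow : 1 - δ / (2 * (1 - q)) < ρ) (hhigh : ρ ≤ 1 + δ / (2 * q)) :
    ENNReal.ofReal ((1 - δ / (2 * (1 - q))) / (ρ * q)) ≤ worstRatio μ (δ * μ) (ρ * μ) := by
  rcases le_or_gt (1 - δ / (2 * (1 - q))) 0 with hneg | hpos
  · rw [ENNReal.ofReal_of_nonpos (div_nonpos_of_nonpos_of_nonneg hneg (by positivity))]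
    exact zero_le
  have hx : 0 < (1 - δ / (2 * (1 - q))) * μ := mul_pos hpos hμ
  have ha := mul_lt_mul_of_pos_right hlow hμ
  have hc := mul_le_mul_of_nonneg_right hhigh hμ.le
  refine le_trans (le_of_eq ?_) (div_le_worstRatio hx (twoPoint_mem_madSet hμ hδ h0 h1))
  rw [REV_twoPoint_low h0.le h1.le (ha.trans_le hc).le, REV_twoPoint_high ha hc,
    ← ENNReal.ofReal_mul (by positivity), ← ENNReal.ofReal_div_of_pos (by positivity)]
  congr 1
  rw [mul_right_comm ρ μ q, mul_div_mul_right _ _ hμ.ne']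

theorem worstRatio_eq_top {μ δ ρ : ℝ} (hμ : 0 < μ) (hδ : 0 < δ) (hρ : 0 < ρ)
    (h : 1 - δ / 2 ≤ ρ) : worstRatio μ (δ * μ) (ρ * μ) = ⊤ := by
  refine ENNReal.eq_top_of_forall_nnreal_le fun M => ?_
  have hM : (0 : ℝ) ≤ M := M.2
  set q : ℝ := δ / (2 * (δ + ρ + M * ρ)) with hq
  have hden : 0 < δ + ρ + M * ρ := by positivity
  have h0 : 0 < q := by positivity
  have h1 : q < 1 := by
    rw [hq, div_lt_one (by positivity)]
    have : 0 ≤ M * ρ := by positivity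
    linarith
  have hval : δ / (2 * q) = δ + ρ + M * ρ := by
    rw [hq]
    field_simp
  have hlow : 1 - δ / (2 * (1 - q)) < ρ := by
    have : δ / 2 < δ / (2 * (1 - q)) :=
      div_lt_div_of_pos_left hδ (by linarith) (by linarith)
    linarith
  have hhigh : ρ ≤ 1 + δ / (2 * q) := by
    rw [hval]
    have : 0 ≤ M * ρ := by positivity
    linarith
  refine le_trans ?_ (high_price_le_worstRatio hμ hδ hρ h0 h1 hlow hhigh)
  rw [← ENNReal.ofReal_coe_nnreal]
  refine ENNReal.ofReal_le_ofReal ?_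
  rw [hval, le_div_iff₀ hρ]
  linarith

/-- The least possible probability of a sale at the price `ρ * μ`, for `ρ < 1 - δ / 2`. -/
noncomputable def minSale (δ ρ : ℝ) : ℝ := 1 - δ / (2 * (1 - ρ))

theorem minSale_pos {δ ρ : ℝ} (hδ : 0 < δ) (h : ρ < 1 - δ / 2) : 0 < minSale δ ρ := by
  rw [minSale, sub_pos, div_lt_one (by linarith)]
  linarith

theorem minSale_lt_one {δ ρ : ℝ} (hδ : 0 < δ) (h : ρ < 1 - δ / 2) : minSale δ ρ < 1 := by
  have : 0 < δ / (2 * (1 - ρ)) := div_pos hδ (by linarith)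
  rw [minSale]
  linarith

theorem minSale_eq_div {δ ρ : ℝ} (h : ρ < 1) :
    minSale δ ρ = (2 - δ - 2 * ρ) / (2 * (1 - ρ)) := by
  have : 1 - ρ ≠ 0 := by linarith
  rw [minSale]
  field_simp
  ring

theorem minSale_minSale {δ ρ : ℝ} (hδ : 0 < δ) (h : ρ < 1 - δ / 2) :
    1 - δ / (2 * (1 - minSale δ ρ)) = ρ := by
  have : 1 - ρ ≠ 0 := by linarith
  have hδ' : δ ≠ 0 := hδ.ne'
  rw [minSale, sub_sub_cancel]
  field_simp
  ring

theorem minSale_lt_of_lt {δ ρ q : ℝ} (hδ : 0 < δ) (h : ρ < 1 - δ / 2) (hq : minSale δ ρ < q)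
    (h1 : q < 1) : 1 - δ / (2 * (1 - q)) < ρ := by
  have hm := minSale_minSale hδ h
  have : δ / (2 * (1 - minSale δ ρ)) < δ / (2 * (1 - q)) :=
    div_lt_div_of_pos_left hδ (by linarith) (by linarith)
  linarith

open Filter Topology in
theorem le_worstRatio_of_tendsto {μ δ ρ : ℝ} (hδ : 0 < δ) (h : ρ < 1 - δ / 2) {f : ℝ → ℝ}
    (hf : ContinuousAt f (minSale δ ρ))
    (hle : ∀ q, 0 < q → q < 1 → 1 - δ / (2 * (1 - q)) < ρ → ρ ≤ 1 + δ / (2 * q) →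
      ENNReal.ofReal (f q) ≤ worstRatio μ (δ * μ) (ρ * μ)) :
    ENNReal.ofReal (f (minSale δ ρ)) ≤ worstRatio μ (δ * μ) (ρ * μ) := by
  have ht : Tendsto (fun q => ENNReal.ofReal (f q)) (𝓝[>] (minSale δ ρ))
      (𝓝 (ENNReal.ofReal (f (minSale δ ρ)))) :=
    ENNReal.tendsto_ofReal (hf.tendsto.mono_left nhdsWithin_le_nhds)
  refine le_of_tendsto ht ?_
  filter_upwards [Ioo_mem_nhdsGT (minSale_lt_one hδ h)] with q hq
  have h0 : 0 < q := (minSale_pos hδ h).trans hq.1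
  refine hle q h0 hq.2 (minSale_lt_of_lt hδ h hq.1 hq.2) ?_
  have : 0 < δ / (2 * q) := by positivity
  linarith

theorem high_ratio_le_worstRatio {μ δ ρ : ℝ} (hμ : 0 < μ) (hδ : 0 < δ) (hρ : 0 < ρ)
    (h : ρ < 1 - δ / 2) :
    ENNReal.ofReal ((1 + δ / (2 * minSale δ ρ)) / ρ) ≤ worstRatio μ (δ * μ) (ρ * μ) := by
  have hQ := minSale_pos hδ h
  refine le_worstRatio_of_tendsto (f := fun q => (1 + δ / (2 * q)) / ρ) hδ h ?_
    fun q h0 h1 hl hh => high_price_le_worstRatio hμ hδ hρ h0 h1 hl hh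
  have : 2 * minSale δ ρ ≠ 0 := by positivity
  fun_prop (disch := assumption)

theorem inv_minSale_le_worstRatio {μ δ ρ : ℝ} (hμ : 0 < μ) (hδ : 0 < δ) (hρ : 0 < ρ)
    (h : ρ < 1 - δ / 2) :
    ENNReal.ofReal (1 / minSale δ ρ) ≤ worstRatio μ (δ * μ) (ρ * μ) := by
  have hQ := minSale_pos hδ h
  have hQ1 := minSale_lt_one hδ h
  have key := le_worstRatio_of_tendsto (μ := μ)
    (f := fun q => (1 - δ / (2 * (1 - q))) / (ρ * q)) hδ h ?_
    fun q h0 h1 hl hh => low_price_le_worstRatio hμ hδ hρ h0 h1 hl hh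
  · beta_reduce at key
    rwa [minSale_minSale hδ h, div_mul_eq_div_div, div_self hρ.ne'] at key
  · have h1 : 2 * (1 - minSale δ ρ) ≠ 0 := by
      have : 0 < 1 - minSale δ ρ := by linarith
      positivity
    have h2 : ρ * minSale δ ρ ≠ 0 := by positivity
    fun_prop (disch := assumption)

section UpperBound

variable {μ d : ℝ} {P : Measure ℝ}

theorem integrable_abs_sub_mean (hP : P ∈ madSet μ d) : Integrable (fun x => |x - μ|) P := by
  have := hP.1
  exact (hP.2.1.sub (integrable_const μ)).abs

theorem integral_sub_mean (hP : P ∈ madSet μ d) : ∫ x, (x - μ) ∂P = 0 := by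
  have := hP.1
  rw [integral_sub hP.2.1 (integrable_const μ), hP.2.2.1]
  simp

theorem mul_measureReal_Ici_le (hP : P ∈ madSet μ d) (x : ℝ) :
    (x - μ) * P.real (Set.Ici x) ≤ d / 2 := by
  have := hP.1
  have hI := integrable_abs_sub_mean hP
  have hJ : Integrable (fun x => x - μ) P := hP.2.1.sub (integrable_const μ)
  have h1 : ∫ y, (Set.Ici x).indicator (fun _ => x - μ) y ∂P = (x - μ) * P.real (Set.Ici x) := by
    rw [integral_indicator_const _ measurableSet_Ici, smul_eq_mul, mul_comm]
  have h2 : ∫ y, (|y - μ| + (y - μ)) / 2 ∂P = d / 2 := by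
    rw [integral_div, integral_add hI hJ, integral_sub_mean hP, hP.2.2.2, add_zero]
  rw [← h1, ← h2]
  refine integral_mono ((integrable_const _).indicator measurableSet_Ici)
    ((hI.add hJ).div_const 2) fun y => ?_
  beta_reduce
  by_cases hy : y ∈ Set.Ici x
  · rw [Set.indicator_of_mem hy]
    have : x ≤ y := hy
    linarith [le_abs_self (y - μ)]
  · rw [Set.indicator_of_notMem hy]
    linarith [neg_abs_le (y - μ)]

theorem mul_measureReal_Iio_le (hP : P ∈ madSet μ d) (r : ℝ) :
    (μ - r) * P.real (Set.Iio r) ≤ d / 2 := by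
  have := hP.1
  have hI := integrable_abs_sub_mean hP
  have hJ : Integrable (fun x => x - μ) P := hP.2.1.sub (integrable_const μ)
  have h1 : ∫ y, (Set.Iio r).indicator (fun _ => μ - r) y ∂P = (μ - r) * P.real (Set.Iio r) := by
    rw [integral_indicator_const _ measurableSet_Iio, smul_eq_mul, mul_comm]
  have h2 : ∫ y, (|y - μ| - (y - μ)) / 2 ∂P = d / 2 := by
    rw [integral_div, integral_sub hI hJ, integral_sub_mean hP, hP.2.2.2, sub_zero]
  rw [← h1, ← h2]
  refine integral_mono ((integrable_const _).indicator measurableSet_Iio)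
    ((hI.sub hJ).div_const 2) fun y => ?_
  beta_reduce
  by_cases hy : y ∈ Set.Iio r
  · rw [Set.indicator_of_mem hy]
    have : y < r := hy
    linarith [neg_abs_le (y - μ)]
  · rw [Set.indicator_of_notMem hy]
    linarith [le_abs_self (y - μ)]

theorem minSale_le_measureReal_Ici {δ ρ : ℝ} (hμ : 0 < μ) (hρ : ρ < 1)
    (hP : P ∈ madSet μ (δ * μ)) : minSale δ ρ ≤ P.real (Set.Ici (ρ * μ)) := by
  have := hP.1
  have h1 := mul_measureReal_Iio_le hP (ρ * μ)
  have h2 := probReal_compl_eq_one_sub (μ := P) (measurableSet_Ici (a := ρ * μ))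
  rw [Set.compl_Ici] at h2
  rw [h2] at h1
  have h3 : (1 - ρ) * (1 - P.real (Set.Ici (ρ * μ))) ≤ δ / 2 :=
    le_of_mul_le_mul_right (by linarith) hμ
  have h4 : 0 < 1 - ρ := by linarith
  have h5 : 1 - P.real (Set.Ici (ρ * μ)) ≤ δ / (2 * (1 - ρ)) := by
    rw [le_div_iff₀ (by positivity)]
    linarith
  rw [minSale]
  linarith

theorem mul_measureReal_le_mul_revenue {δ ρ V : ℝ} (hμ : 0 < μ) (hδ : 0 < δ) (hρ : 0 < ρ)
    (h : ρ < 1 - δ / 2) (hV1 : 1 / minSale δ ρ ≤ V) (hV2 : (1 + δ / (2 * minSale δ ρ)) / ρ ≤ V)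
    (hP : P ∈ madSet μ (δ * μ)) {x : ℝ} :
    x * P.real (Set.Ici x) ≤ V * (ρ * μ * P.real (Set.Ici (ρ * μ))) := by
  have := hP.1
  have hQ := minSale_pos hδ h
  have hle := minSale_le_measureReal_Ici hμ (by linarith : ρ < 1) hP
  set p := P.real (Set.Ici (ρ * μ))
  have hp : 0 < p := hQ.trans_le hle
  rw [div_le_iff₀ hQ] at hV1
  have hV : 0 < V := by
    by_contra hn
    nlinarith
  have hVp : 1 ≤ V * p := hV1.trans (mul_le_mul_of_nonneg_left hle hV.le)
  have hs0 : 0 ≤ P.real (Set.Ici x) := measureReal_nonneg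
  rcases le_or_gt x (ρ * μ) with hx | hx
  · have hs1 : P.real (Set.Ici x) ≤ 1 := measureReal_le_one
    have hρμ : 0 < ρ * μ := by positivity
    calc x * P.real (Set.Ici x) ≤ ρ * μ * P.real (Set.Ici x) := by gcongr
      _ ≤ ρ * μ * 1 := by gcongr
      _ ≤ ρ * μ * (V * p) := by gcongr
      _ = V * (ρ * μ * p) := by ring
  · have hsp : P.real (Set.Ici x) ≤ p := measureReal_mono (Set.Ici_subset_Ici.2 hx.le)
    have h1 := mul_measureReal_Ici_le hP x
    have h2 : μ * P.real (Set.Ici x) ≤ μ * p := by gcongr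
    have h3 : (1 + δ / (2 * p)) / ρ ≤ V := le_trans (by gcongr) hV2
    rw [div_le_iff₀ hρ] at h3
    have h4 : (1 + δ / (2 * p)) * (p * μ) ≤ V * ρ * (p * μ) := by gcongr
    have h5 : (1 + δ / (2 * p)) * (p * μ) = μ * p + δ * μ / 2 := by field_simp
    linarith

theorem worstRatio_le {δ ρ V : ℝ} (hμ : 0 < μ) (hδ : 0 < δ) (hρ : 0 < ρ)
    (h : ρ < 1 - δ / 2) (hV1 : 1 / minSale δ ρ ≤ V)
    (hV2 : (1 + δ / (2 * minSale δ ρ)) / ρ ≤ V) :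
    worstRatio μ (δ * μ) (ρ * μ) ≤ ENNReal.ofReal V := by
  have hV : 0 ≤ V := le_trans (one_div_pos.2 (minSale_pos hδ h)).le hV1
  refine iSup₂_le fun P hP => ENNReal.div_le_of_le_mul (iSup₂_le fun x hx => ?_)
  have := hP.1
  have hreal := mul_measureReal_le_mul_revenue hμ hδ hρ h hV1 hV2 hP (x := x)
  rw [REV, REV, ← ofReal_measureReal (μ := P), ← ofReal_measureReal (μ := P),
    ← ENNReal.ofReal_mul hx.le, ← ENNReal.ofReal_mul (by positivity), ← ENNReal.ofReal_mul hV]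
  exact ENNReal.ofReal_le_ofReal hreal

end UpperBound

theorem high_ratio_eq {δ ρ : ℝ} (hδ : 0 < δ) (hρ : 0 < ρ) (h : ρ < 1 - δ / 2) :
    (1 + δ / (2 * minSale δ ρ)) / ρ = (2 - (2 + δ) * ρ) / (ρ * (2 - δ - 2 * ρ)) := by
  have h1 : 1 - ρ ≠ 0 := by linarith
  have h2 : 2 - δ - 2 * ρ ≠ 0 := by linarith
  rw [minSale_eq_div (by linarith)]
  field_simp
  ring

/-- It suffices to compare the two explicit ratios on `ρ < 1 - δ / 2`. -/
theorem isOptimalPrice_of_ratios {μ δ ρ V : ℝ} (hμ : 0 < μ) (hδ : 0 < δ) (hρ : 0 < ρ)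
    (h : ρ < 1 - δ / 2) (hV1 : 1 / minSale δ ρ ≤ V)
    (hV2 : (1 + δ / (2 * minSale δ ρ)) / ρ = V)
    (hstrict : ∀ σ, 0 < σ → σ < 1 - δ / 2 → σ ≠ ρ →
      V < 1 / minSale δ σ ∨ V < (1 + δ / (2 * minSale δ σ)) / σ) :
    ρ * μ < μ ∧ IsOptimalPrice μ (δ * μ) (ρ * μ) V := by
  have hV : 0 ≤ V := le_trans (one_div_pos.2 (minSale_pos hδ h)).le hV1
  refine ⟨mul_lt_of_lt_one_left hμ (by linarith), by positivity, hV,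
    le_antisymm (worstRatio_le hμ hδ hρ h hV1 hV2.le) ?_, fun r hr hne => ?_⟩
  · rw [← hV2]
    exact high_ratio_le_worstRatio hμ hδ hρ h
  · obtain ⟨σ, rfl⟩ : ∃ σ, r = σ * μ := ⟨r / μ, by field_simp⟩
    have hσ : 0 < σ := pos_of_mul_pos_left hr hμ.le
    have hσρ : σ ≠ ρ := fun e => hne (by rw [e])
    rcases lt_or_ge σ (1 - δ / 2) with hlt | hge
    · rcases hstrict σ hσ hlt hσρ with hs | hs
      · exact ((ENNReal.ofReal_lt_ofReal_iff_of_nonneg hV).2 hs).trans_le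
          (inv_minSale_le_worstRatio hμ hδ hσ hlt)
      · exact ((ENNReal.ofReal_lt_ofReal_iff_of_nonneg hV).2 hs).trans_le
          (high_ratio_le_worstRatio hμ hδ hσ hlt)
    · rw [worstRatio_eq_top hμ hδ hσ hge]
      exact ENNReal.ofReal_lt_top

theorem minSale_strictAnti {δ ρ σ : ℝ} (hδ : 0 < δ) (hρσ : ρ < σ) (hσ : σ < 1) :
    minSale δ σ < minSale δ ρ := by
  have : δ / (2 * (1 - ρ)) < δ / (2 * (1 - σ)) :=
    div_lt_div_of_pos_left hδ (by linarith) (by linarith)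
  rw [minSale, minSale]
  linarith

theorem high_ratio_strictAnti {δ ρ σ : ℝ} (hδ : 0 < δ) (hσ : 0 < σ)
    (hσρ : σ < ρ) (hρ : ρ ≤ (2 - δ) / (2 + δ)) (h : ρ < 1 - δ / 2) :
    (1 + δ / (2 * minSale δ ρ)) / ρ < (1 + δ / (2 * minSale δ σ)) / σ := by
  have hρ0 : 0 < ρ := hσ.trans hσρ
  rw [high_ratio_eq hδ hρ0 h, high_ratio_eq hδ hσ (hσρ.trans h),
    div_lt_div_iff₀ (mul_pos hρ0 (by linarith)) (mul_pos hσ (by linarith))]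
  rw [le_div_iff₀ (by linarith)] at hρ
  have hc : 0 < 2 + δ := by linarith
  have h1 : δ ≤ 2 - (2 + δ) * ρ := by linarith
  have h2 : δ < 2 - (2 + δ) * σ := by nlinarith
  have h3 : δ * δ < (2 - (2 + δ) * σ) * (2 - (2 + δ) * ρ) :=
    mul_lt_mul h2 h1 hδ (by linarith)
  have h4 : 0 < (2 + δ) * ((2 - δ) - 2 * (σ + ρ) + (2 + δ) * (σ * ρ)) := by linarith
  have h5 : 0 < (2 - δ) - 2 * (σ + ρ) + (2 + δ) * (σ * ρ) := pos_of_mul_pos_right h4 hc.le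
  have h6 := mul_pos (sub_pos.2 hσρ) h5
  linarith

theorem optimalPrice_of_small_mad {μ δ : ℝ} (hμ : 0 < μ) (hδ0 : 0 < δ)
    (hδ : δ ≤ 2 * (Real.sqrt 5 - 2)) :
    (4 + δ - Real.sqrt (δ ^ 2 + 8 * δ)) / 4 * μ < μ ∧
      IsOptimalPrice μ (δ * μ) ((4 + δ - Real.sqrt (δ ^ 2 + 8 * δ)) / 4 * μ)
        (1 + 2 * δ / (Real.sqrt (δ ^ 2 + 8 * δ) - 3 * δ)) := by
  have h5 : Real.sqrt 5 ^ 2 = 5 := Real.sq_sqrt (by norm_num)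
  have hthr : δ ^ 2 + 8 * δ ≤ 4 := by nlinarith [Real.sqrt_nonneg 5]
  have hδ1 : δ < 1 := by nlinarith
  set s := Real.sqrt (δ ^ 2 + 8 * δ) with hs
  have hs0 : 0 ≤ s := Real.sqrt_nonneg _
  have hs2 : s ^ 2 = δ ^ 2 + 8 * δ := Real.sq_sqrt (by positivity)
  have hs3 : 3 * δ < s := Real.lt_sqrt_of_sq_lt (by nlinarith)
  have hs4 : s < 4 + δ := by nlinarith
  set ρ := (4 + δ - s) / 4 with hρ
  have hρ0 : 0 < ρ := by rw [hρ]; linarith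
  have hρ1 : ρ < 1 - δ / 2 := by rw [hρ]; linarith
  have hρle : ρ ≤ (2 - δ) / (2 + δ) := by
    have : δ * (δ + 10) ≤ (2 + δ) * s := by
      refine le_of_sq_le_sq ?_ (by positivity)
      rw [mul_pow (2 + δ), hs2]
      nlinarith
    rw [le_div_iff₀ (by linarith), hρ]
    linarith
  have hcross : 2 * (1 - ρ) ^ 2 = δ * ρ := by
    rw [hρ]
    linear_combination hs2 / 8
  have hQ : 1 / minSale δ ρ = 1 + 2 * δ / (s - 3 * δ) := by
    have h1 : s - 3 * δ ≠ 0 := by linarith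
    have h2 : 2 - δ - 2 * ρ = (s - 3 * δ) / 2 := by rw [hρ]; ring
    have h3 : 2 * (1 - ρ) = (s - δ) / 2 := by rw [hρ]; ring
    rw [minSale_eq_div (by linarith), h2, h3]
    field_simp
    ring
  have hG : (1 + δ / (2 * minSale δ ρ)) / ρ = 1 / minSale δ ρ := by
    have h1 : 1 - ρ ≠ 0 := by linarith
    have h2 : 2 - δ - 2 * ρ ≠ 0 := by linarith
    rw [high_ratio_eq hδ0 hρ0 hρ1, minSale_eq_div (by linarith)]
    field_simp
    linear_combination hcross
  refine isOptimalPrice_of_ratios hμ hδ0 hρ0 hρ1 hQ.le (hG.trans hQ) fun σ hσ hσ1 hne => ?_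
  rcases lt_or_gt_of_ne hne with hlt | hgt
  · right
    rw [← hQ, ← hG]
    exact high_ratio_strictAnti hδ0 hσ hlt hρle hρ1
  · left
    rw [← hQ]
    exact one_div_lt_one_div_of_lt (minSale_pos hδ0 hσ1)
      (minSale_strictAnti hδ0 hgt (by linarith))

theorem optimalPrice_of_large_mad {μ δ : ℝ} (hμ : 0 < μ) (hδ0 : 0 < δ) (hδ2 : δ < 2)
    (hδ : 2 * (Real.sqrt 5 - 2) ≤ δ) :
    (2 - δ) / (2 + δ) * μ < μ ∧
      IsOptimalPrice μ (δ * μ) ((2 - δ) / (2 + δ) * μ) (1 + 8 * δ / (2 - δ) ^ 2) := by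
  have h5 : Real.sqrt 5 ^ 2 = 5 := Real.sq_sqrt (by norm_num)
  have hthr : 4 ≤ δ ^ 2 + 8 * δ := by nlinarith [Real.sqrt_nonneg 5]
  have hm : 0 < 2 - δ := by linarith
  have hc : 0 < 2 + δ := by linarith
  have hρ0 : 0 < (2 - δ) / (2 + δ) := by positivity
  have hρ1 : (2 - δ) / (2 + δ) < 1 - δ / 2 := by
    rw [div_lt_iff₀ hc]
    nlinarith
  have hV : 1 + 8 * δ / (2 - δ) ^ 2 = (2 + δ) ^ 2 / (2 - δ) ^ 2 := by
    field_simp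
    ring
  have hQ : minSale δ ((2 - δ) / (2 + δ)) = (2 - δ) / 4 := by
    have : 1 - (2 - δ) / (2 + δ) = 2 * δ / (2 + δ) := by
      field_simp
      ring
    rw [minSale, this]
    field_simp
    ring
  refine isOptimalPrice_of_ratios hμ hδ0 hρ0 hρ1 ?_ ?_ fun σ hσ hσ1 hne => Or.inr ?_
  · rw [hQ, hV, div_le_div_iff₀ (by positivity) (by positivity)]
    nlinarith
  · rw [hQ, hV]
    field_simp
    ring
  · rw [hV, high_ratio_eq hδ0 hσ hσ1,
      div_lt_div_iff₀ (by positivity) (mul_pos hσ (by linarith))]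
    have hne' : (2 - δ) - (2 + δ) * σ ≠ 0 := fun e => hne (by
      rw [eq_div_iff hc.ne']
      linarith)
    have := pow_pos (abs_pos.2 hne') 2
    rw [sq_abs] at this
    linarith

theorem stmt19 (μ δ : ℝ) (hμ : 0 < μ) (hδ0 : 0 < δ) (hδ2 : δ < 2) :
    (δ ≤ 2 * (Real.sqrt 5 - 2) →
      (4 + δ - Real.sqrt (δ ^ 2 + 8 * δ)) / 4 * μ < μ ∧
      IsOptimalPrice μ (δ * μ)
        ((4 + δ - Real.sqrt (δ ^ 2 + 8 * δ)) / 4 * μ)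
        (1 + 2 * δ / (Real.sqrt (δ ^ 2 + 8 * δ) - 3 * δ))) ∧
    (2 * (Real.sqrt 5 - 2) ≤ δ →
      (2 - δ) / (2 + δ) * μ < μ ∧
      IsOptimalPrice μ (δ * μ)
        ((2 - δ) / (2 + δ) * μ)
        (1 + 8 * δ / (2 - δ) ^ 2)) := by
  exact ⟨optimalPrice_of_small_mad hμ hδ0, optimalPrice_of_large_mad hμ hδ0 hδ2⟩
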